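/- Proposition 4, necessity direction (one-to-one aggregation mapping): suppose each agent i ∈ I chooses a strategy a_i, and, because the market aggregation mapping f̃ is one-to-one, each agent can recover the others' actual strategies exactly from the observed SDF, i.e. A_{-i}(m̃, a_i) is the singleton {(a_j)_{j≠i}}. If no agent i's strategy a_i is dominated relative to {(a_j)_{j≠i}} (there is no tradeable arbitrage opportunity in the market), then every agent's strategy satisfies a_i ∈ ⋂_{n≥0} UD_i^n; that is, every market participant chooses a response in the intersection of all her undominated response sets, exercising her entire infinite belief hierarchy. -/

import Mathlib

open MeasureTheory
open scoped Classical

namespace ArbitrageBeliefs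

variable {I : Type*} {A : I → Type*} {S : Type*}

/-- Splice agent `i`'s strategy `ai` together with a profile `b` of the other
agents' strategies into a full strategy profile. -/
noncomputable def splice (i : I) (ai : A i)
    (b : ∀ j : {j : I // j ≠ i}, A j.1) : ∀ j, A j := fun j =>
  if h : j = i then h.symm ▸ ai else b ⟨j, h⟩

/-- Agent `i`'s strategy `ai` is dominated relative to a set `T` of profiles of
the other agents' strategies: against every profile in `T` there is an
alternative strategy that gives `P`-a.s. weakly higher utility and strictly
higher utility with positive probability. -/
def Dominated [MeasurableSpace S] (P : Measure S)
    (Ui : (∀ j, A j) → S → ℝ) (i : I) (ai : A i)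
    (T : Set (∀ j : {j : I // j ≠ i}, A j.1)) : Prop :=
  ∀ b ∈ T, ∃ ai' : A i,
    (∀ᵐ s ∂P, Ui (splice i ai b) s ≤ Ui (splice i ai' b) s) ∧
    0 < P {s | Ui (splice i ai b) s < Ui (splice i ai' b) s}

/-- The undominated response sets, defined by simultaneous recursion:
`UD P U 0 i = A i` and
`UD P U (k+1) i = {ai ∈ UD P U k i : ai not dominated rel. ∏_{j ≠ i} UD P U k j}`. -/
def UD [MeasurableSpace S] (P : Measure S)
    (U : ∀ i : I, (∀ j, A j) → S → ℝ) : ℕ → ∀ i, Set (A i)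
  | 0 => fun _ => Set.univ
  | (k + 1) => fun i =>
      {ai | ai ∈ UD P U k i ∧
        ¬ Dominated P (U i) i ai {b | ∀ j, b j ∈ UD P U k j.1}}

/-- The product set `∏_{j ≠ i} UD_j^k` of the other agents' undominated
`k`-th order responses. -/
def PiUD [MeasurableSpace S] (P : Measure S)
    (U : ∀ i : I, (∀ j, A j) → S → ℝ) (k : ℕ) (i : I) :
    Set (∀ j : {j : I // j ≠ i}, A j.1) :=
  {b | ∀ j, b j ∈ UD P U k j.1}

/-- Domination relative to a set of profiles is inherited by its subsets. -/
theorem Dominated.mono [MeasurableSpace S] {P : Measure S}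
    {Ui : (∀ j, A j) → S → ℝ} {i : I} {ai : A i}
    {T T' : Set (∀ j : {j : I // j ≠ i}, A j.1)}
    (h : Dominated P Ui i ai T) (hT : T' ⊆ T) : Dominated P Ui i ai T' :=
  fun b hb => h b (hT hb)

/-- Proposition 4, necessity: with a one-to-one aggregation mapping
each agent backs out exactly the others' actual strategies; if no agent's strategy
is dominated relative to the singleton of the others' actual profile, then every
agent's strategy lies in `⋂_n UD_i^n`. -/
theorem one_to_one_no_arbitrage_necessary [Fintype I] [∀ i, Nonempty (A i)]
    [MeasurableSpace S] (P : Measure S) [IsProbabilityMeasure P]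
    (U : ∀ i : I, (∀ j, A j) → S → ℝ)
    (hU : ∀ (i : I) (a : ∀ j, A j), Measurable (U i a))
    (a : ∀ i, A i)
    (hnoarb : ∀ i : I, ¬ Dominated P (U i) i (a i)
      {fun j : {j : I // j ≠ i} => a j.1}) :
    ∀ i, a i ∈ ⋂ n : ℕ, UD P U n i := by
  intro i
  refine Set.mem_iInter.2 fun n => ?_
  induction n generalizing i with
  | zero => exact Set.mem_univ _
  | succ k ih =>
    exact ⟨ih i, fun h => hnoarb i
      (h.mono (Set.singleton_subset_iff.2 fun j => ih j.1))⟩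

end ArbitrageBeliefs
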